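/- Let m, d be real numbers with |d| < 1. Define λ₁(x,t) = 0.5·m³·t + m·x, λ₂(x,t) = 0.5·m³·t − m·x, θ₁(x,t) = −2m²·(−1 + d² + 2d·sin(λ₁)·sinh(λ₂))/(d·cos(λ₁) + cosh(λ₂))², and θ₂(x,t) = √(2 + 2d²)·m²/(d·cos(λ₁) + cosh(λ₂)). Then (θ₁, θ₂) is a solution of the Hirota–Satsuma system: for all (x,t), ∂ₜθ₁ − 0.25·∂ₓ³θ₁ − 1.5·θ₁·∂ₓθ₁ + 3·θ₂·∂ₓθ₂ = 0 and ∂ₜθ₂ + 0.5·∂ₓ³θ₂ + 1.5·θ₁·∂ₓθ₂ = 0. -/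

import Mathlib

/-- If `F`, `G`, `H` have derivatives `m G`, `m H`, `m K` and `F` has no zeros, this is the third
derivative of `1 / F`. -/
theorem iteratedDeriv_three_inv_of_cyclic {m : ℝ} {F G H K : ℝ → ℝ}
    (hF : ∀ y, HasDerivAt F (m * G y) y) (hG : ∀ y, HasDerivAt G (m * H y) y)
    (hH : ∀ y, HasDerivAt H (m * K y) y) (h0 : ∀ y, F y ≠ 0) (A x : ℝ) :
    iteratedDeriv 3 (fun y => A / F y) x =
      A * m ^ 3 * (-K x / F x ^ 2 + 6 * G x * H x / F x ^ 3 - 6 * G x ^ 3 / F x ^ 4) := by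
  have h1 : deriv (fun y => A / F y) = fun y => A * m * (-G y / F y ^ 2) := by
    funext y
    have := h0 y
    refine ((hasDerivAt_const y A).div (hF y) this).deriv.trans ?_
    field_simp
    ring
  have h2 : deriv (fun y => A * m * (-G y / F y ^ 2)) =
      fun y => A * m ^ 2 * (-H y / F y ^ 2 + 2 * G y ^ 2 / F y ^ 3) := by
    funext y
    have := h0 y
    refine (((hG y).neg.div ((hF y).pow 2) (pow_ne_zero 2 this)).const_mul (A * m)).deriv.trans ?_
    simp only [Pi.neg_apply, Pi.pow_apply]
    field_simp
    ring
  rw [iteratedDeriv_succ, iteratedDeriv_succ, iteratedDeriv_one, h1, h2]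
  have := h0 x
  refine ((((hH x).neg.div ((hF x).pow 2) (pow_ne_zero 2 this)).add
    ((((hG x).pow 2).const_mul 2).div ((hF x).pow 3) (pow_ne_zero 3 this))).const_mul
      (A * m ^ 2)).deriv.trans ?_
  simp only [Pi.neg_apply, Pi.pow_apply]
  field_simp
  ring

/-- The first derivative of `H / F - G ^ 2 / F ^ 2` when `F`, `G`, `H` have derivatives `m G`,
`m H`, `m K`. -/
theorem hasDerivAt_div_sub_sq_div_of_cyclic {m : ℝ} {F G H K : ℝ → ℝ} {x : ℝ}
    (hF : HasDerivAt F (m * G x) x) (hG : HasDerivAt G (m * H x) x)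
    (hH : HasDerivAt H (m * K x) x) (h0 : F x ≠ 0) (A : ℝ) :
    HasDerivAt (fun y => A * (H y / F y - G y ^ 2 / F y ^ 2))
      (A * m * (K x / F x - 3 * H x * G x / F x ^ 2 + 2 * G x ^ 3 / F x ^ 3)) x := by
  refine (((hH.div hF h0).sub ((hG.pow 2).div (hF.pow 2) (pow_ne_zero 2 h0))).const_mul
    A).congr_deriv ?_
  simp only [Pi.pow_apply]
  field_simp
  ring

/-- The third derivative of `H / F - G ^ 2 / F ^ 2` when `F`, `G`, `H`, `K` have derivatives
`m G`, `m H`, `m K`, `m F`. -/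
theorem iteratedDeriv_three_div_sub_sq_div_of_cyclic {m : ℝ} {F G H K : ℝ → ℝ}
    (hF : ∀ y, HasDerivAt F (m * G y) y) (hG : ∀ y, HasDerivAt G (m * H y) y)
    (hH : ∀ y, HasDerivAt H (m * K y) y) (hK : ∀ y, HasDerivAt K (m * F y) y)
    (h0 : ∀ y, F y ≠ 0) (A x : ℝ) :
    iteratedDeriv 3 (fun y => A * (H y / F y - G y ^ 2 / F y ^ 2)) x =
      A * m ^ 3 * (-4 * G x / F x - 10 * K x * H x / F x ^ 2 + 20 * K x * G x ^ 2 / F x ^ 3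
        + 30 * H x ^ 2 * G x / F x ^ 3 - 60 * H x * G x ^ 3 / F x ^ 4
        + 24 * G x ^ 5 / F x ^ 5) := by
  have h1 : deriv (fun y => A * (H y / F y - G y ^ 2 / F y ^ 2)) = fun y =>
      A * m * (K y / F y - 3 * (H y * G y) / F y ^ 2 + 2 * G y ^ 3 / F y ^ 3) := by
    funext y
    rw [(hasDerivAt_div_sub_sq_div_of_cyclic (hF y) (hG y) (hH y) (h0 y) A).deriv]
    ring
  have h2 : deriv (fun y =>
      A * m * (K y / F y - 3 * (H y * G y) / F y ^ 2 + 2 * G y ^ 3 / F y ^ 3)) = fun y =>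
      A * m ^ 2 * (1 - (4 * (K y * G y) + 3 * H y ^ 2) / F y ^ 2
        + 12 * (H y * G y ^ 2) / F y ^ 3 - 6 * G y ^ 4 / F y ^ 4) := by
    funext y
    have := h0 y
    refine (((((hK y).div (hF y) this).sub
      ((((hH y).mul (hG y)).const_mul 3).div ((hF y).pow 2) (pow_ne_zero 2 this))).add
      ((((hG y).pow 3).const_mul 2).div ((hF y).pow 3) (pow_ne_zero 3 this))).const_mul
        (A * m)).deriv.trans ?_
    simp only [Pi.mul_apply, Pi.pow_apply]
    field_simp
    ring
  rw [iteratedDeriv_succ, iteratedDeriv_succ, iteratedDeriv_one, h1, h2]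
  have := h0 x
  refine ((((((((hK x).mul (hG x)).const_mul 4).add (((hH x).pow 2).const_mul 3)).div
      ((hF x).pow 2) (pow_ne_zero 2 this)).const_sub 1).add
    ((((hH x).mul ((hG x).pow 2)).const_mul 12).div ((hF x).pow 3) (pow_ne_zero 3 this))).sub
    ((((hG x).pow 4).const_mul 6).div ((hF x).pow 4) (pow_ne_zero 4 this))).const_mul
      (A * m ^ 2) |>.deriv.trans ?_
  simp only [Pi.mul_apply, Pi.pow_apply, Pi.add_apply]
  field_simp
  ring

/-- The two-parameter one-soliton formulas solve the Hirota–Satsuma system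
`(θ₁)_t - 0.25(θ₁)_{xxx} - 1.5 θ₁ (θ₁)_x + 3 θ₂ (θ₂)_x = 0`,
`(θ₂)_t + 0.5(θ₂)_{xxx} + 1.5 θ₁ (θ₂)_x = 0`.
Here `θ₁ x t` is the value of the first mode at space `x` and time `t`. -/
theorem stmt_8 (m d : ℝ) (hd : |d| < 1) (θ₁ θ₂ : ℝ → ℝ → ℝ)
    (hθ₁ : ∀ x t : ℝ, θ₁ x t =
      -2 * m ^ 2 *
        (-1 + d ^ 2 +
          2 * d * Real.sin (0.5 * m ^ 3 * t + m * x) * Real.sinh (0.5 * m ^ 3 * t - m * x)) /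
        (d * Real.cos (0.5 * m ^ 3 * t + m * x) + Real.cosh (0.5 * m ^ 3 * t - m * x)) ^ 2)
    (hθ₂ : ∀ x t : ℝ, θ₂ x t =
      Real.sqrt (2 + 2 * d ^ 2) * m ^ 2 /
        (d * Real.cos (0.5 * m ^ 3 * t + m * x) + Real.cosh (0.5 * m ^ 3 * t - m * x))) :
    ∀ x t : ℝ,
      (deriv (fun s => θ₁ x s) t - 0.25 * iteratedDeriv 3 (fun y => θ₁ y t) x
          - 1.5 * θ₁ x t * deriv (fun y => θ₁ y t) x
          + 3 * θ₂ x t * deriv (fun y => θ₂ y t) x = 0) ∧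
      (deriv (fun s => θ₂ x s) t + 0.5 * iteratedDeriv 3 (fun y => θ₂ y t) x
          + 1.5 * θ₁ x t * deriv (fun y => θ₂ y t) x = 0) := by
  have hpos : ∀ a b : ℝ, d * Real.cos a + Real.cosh b ≠ 0 := by
    intro a b
    have h1 : |d * Real.cos a| ≤ |d| := by
      rw [abs_mul]
      exact mul_le_of_le_one_right (abs_nonneg d) (Real.abs_cos_le_one a)
    have h2 := neg_abs_le (d * Real.cos a)
    have h3 := Real.one_le_cosh b
    linarith
  let F : ℝ → ℝ → ℝ := fun x t =>
    d * Real.cos (0.5 * m ^ 3 * t + m * x) + Real.cosh (0.5 * m ^ 3 * t - m * x)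
  let G : ℝ → ℝ → ℝ := fun x t =>
    -(d * Real.sin (0.5 * m ^ 3 * t + m * x)) - Real.sinh (0.5 * m ^ 3 * t - m * x)
  let H : ℝ → ℝ → ℝ := fun x t =>
    -(d * Real.cos (0.5 * m ^ 3 * t + m * x)) + Real.cosh (0.5 * m ^ 3 * t - m * x)
  let K : ℝ → ℝ → ℝ := fun x t =>
    d * Real.sin (0.5 * m ^ 3 * t + m * x) - Real.sinh (0.5 * m ^ 3 * t - m * x)
  have h0 : ∀ x t, F x t ≠ 0 := fun x t => hpos _ _
  have hax : ∀ x t : ℝ, HasDerivAt (fun y => 0.5 * m ^ 3 * t + m * y) m x := fun x t => by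
    simpa using ((hasDerivAt_id x).const_mul m).const_add (0.5 * m ^ 3 * t)
  have hbx : ∀ x t : ℝ, HasDerivAt (fun y => 0.5 * m ^ 3 * t - m * y) (-m) x := fun x t => by
    simpa using ((hasDerivAt_id x).const_mul m).const_sub (0.5 * m ^ 3 * t)
  have hat : ∀ x t : ℝ, HasDerivAt (fun s => 0.5 * m ^ 3 * s + m * x) (0.5 * m ^ 3) t :=
    fun x t => by
      simpa using ((hasDerivAt_id t).const_mul (0.5 * m ^ 3)).add_const (m * x)
  have hbt : ∀ x t : ℝ, HasDerivAt (fun s => 0.5 * m ^ 3 * s - m * x) (0.5 * m ^ 3) t :=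
    fun x t => by
      simpa using ((hasDerivAt_id t).const_mul (0.5 * m ^ 3)).sub_const (m * x)
  have hFx : ∀ t x, HasDerivAt (fun y => F y t) (m * G x t) x := fun t x =>
    (((hax x t).cos.const_mul d).add (hbx x t).cosh).congr_deriv (by simp only [G]; ring)
  have hGx : ∀ t x, HasDerivAt (fun y => G y t) (m * H x t) x := fun t x =>
    (((hax x t).sin.const_mul d).neg.sub (hbx x t).sinh).congr_deriv (by simp only [H]; ring)
  have hHx : ∀ t x, HasDerivAt (fun y => H y t) (m * K x t) x := fun t x =>
    (((hax x t).cos.const_mul d).neg.add (hbx x t).cosh).congr_deriv (by simp only [K]; ring)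
  have hKx : ∀ t x, HasDerivAt (fun y => K y t) (m * F x t) x := fun t x =>
    (((hax x t).sin.const_mul d).sub (hbx x t).sinh).congr_deriv (by simp only [F]; ring)
  have hFt : ∀ x t, HasDerivAt (F x) (-(0.5 * m ^ 3) * K x t) t := fun x t =>
    (((hat x t).cos.const_mul d).add (hbt x t).cosh).congr_deriv (by simp only [K]; ring)
  have hGt : ∀ x t, HasDerivAt (G x) (-(0.5 * m ^ 3) * F x t) t := fun x t =>
    (((hat x t).sin.const_mul d).neg.sub (hbt x t).sinh).congr_deriv (by simp only [F]; ring)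
  have hHt : ∀ x t, HasDerivAt (H x) (-(0.5 * m ^ 3) * G x t) t := fun x t =>
    (((hat x t).cos.const_mul d).neg.add (hbt x t).cosh).congr_deriv (by simp only [G]; ring)
  have hd2 : ∀ x t, 2 + 2 * d ^ 2 = F x t ^ 2 + H x t ^ 2 - 2 * (G x t * K x t) := fun x t => by
    simp only [F, G, H, K]
    linear_combination (-2 * d ^ 2) * Real.sin_sq_add_cos_sq (0.5 * m ^ 3 * t + m * x)
      - 2 * Real.cosh_sq (0.5 * m ^ 3 * t - m * x)
  have e1 : ∀ x t, θ₁ x t = 2 * m ^ 2 * (H x t / F x t - G x t ^ 2 / F x t ^ 2) := fun x t => by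
    have hF0 := h0 x t
    have hN : -1 + d ^ 2 +
        2 * d * Real.sin (0.5 * m ^ 3 * t + m * x) * Real.sinh (0.5 * m ^ 3 * t - m * x) =
        G x t ^ 2 - F x t * H x t := by
      simp only [F, G, H]
      linear_combination (-d ^ 2) * Real.sin_sq_add_cos_sq (0.5 * m ^ 3 * t + m * x)
        + Real.cosh_sq (0.5 * m ^ 3 * t - m * x)
    rw [hθ₁, hN]
    change _ / F x t ^ 2 = _
    field_simp
    ring
  have e2 : ∀ x t, θ₂ x t = Real.sqrt (2 + 2 * d ^ 2) * m ^ 2 / F x t := hθ₂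
  have hsq : Real.sqrt (2 + 2 * d ^ 2) ^ 2 = 2 + 2 * d ^ 2 := Real.sq_sqrt (by positivity)
  intro x t
  have hF0 := h0 x t
  have d1t : deriv (fun s => θ₁ x s) t = m ^ 5 * (G x t / F x t + H x t * K x t / F x t ^ 2
      - 2 * G x t ^ 2 * K x t / F x t ^ 3) := by
    simp only [e1]
    refine ((((hHt x t).div (hFt x t) hF0).sub (((hGt x t).pow 2).div ((hFt x t).pow 2)
      (pow_ne_zero 2 hF0))).const_mul (2 * m ^ 2)).deriv.trans ?_
    simp only [Pi.pow_apply]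
    field_simp
    ring
  have d2t : deriv (fun s => θ₂ x s) t =
      Real.sqrt (2 + 2 * d ^ 2) * m ^ 5 * (0.5 * K x t / F x t ^ 2) := by
    simp only [e2]
    refine ((hasDerivAt_const t _).div (hFt x t) hF0).deriv.trans ?_
    field_simp
    ring
  have d2x : deriv (fun y => θ₂ y t) x =
      Real.sqrt (2 + 2 * d ^ 2) * m ^ 3 * (-G x t / F x t ^ 2) := by
    simp only [e2]
    refine ((hasDerivAt_const x _).div (hFx t x) hF0).deriv.trans ?_
    field_simp
    ring
  have d1x : deriv (fun y => θ₁ y t) x = 2 * m ^ 2 * m * (K x t / F x t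
      - 3 * H x t * G x t / F x t ^ 2 + 2 * G x t ^ 3 / F x t ^ 3) := by
    simp only [e1]
    exact (hasDerivAt_div_sub_sq_div_of_cyclic (K := fun y => K y t) (hFx t x) (hGx t x) (hHx t x)
      hF0 _).deriv
  have d1xxx := iteratedDeriv_three_div_sub_sq_div_of_cyclic (hFx t) (hGx t) (hHx t) (hKx t)
    (fun y => h0 y t) (2 * m ^ 2) x
  have d2xxx := iteratedDeriv_three_inv_of_cyclic (hFx t) (hGx t) (hHx t)
    (fun y => h0 y t) (Real.sqrt (2 + 2 * d ^ 2) * m ^ 2) x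
  rw [← funext fun y => e1 y t] at d1xxx
  rw [← funext fun y => e2 y t] at d2xxx
  rw [d1t, d1x, d1xxx, d2t, d2x, d2xxx, e1, e2]
  have hrel := hsq.trans (hd2 x t)
  clear_value F G H K
  generalize Real.sqrt (2 + 2 * d ^ 2) = r at *
  generalize F x t = f at *
  generalize G x t = g at *
  generalize H x t = h at *
  generalize K x t = k at *
  constructor
  · have key : 3 * (r * m ^ 2 / f) * (r * m ^ 3 * (-g / f ^ 2)) =
        -3 * m ^ 5 * g / f ^ 3 * (f ^ 2 + h ^ 2 - 2 * (g * k)) := by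
      rw [← hrel]
      field_simp
    rw [key]
    field_simp
    ring
  · field_simp
    ring
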